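/- arXiv:0805.2900 — 2 statements merged into one kernel-verified Lean document; each statement's English description precedes it below -/
import Mathlib

section
/- Let d ≥ 2, ω = exp(2iπ/d), and let A, B ∈ U(d) be defined on the canonical basis (e_j)_{0≤j≤d−1} by A(e_j) = e_{j+1 mod d} and B(e_j) = ω^j e_j. For 1 ≤ j,k ≤ d set V_{j,k} = B^j A^k. Then for every d×d complex matrix X, (1/d²)·Σ_{j,k=1}^d V_{j,k} X V_{j,k}† = (tr X)·Id/d. -/
open Matrix
open scoped Real

noncomputable section

/-- The shift matrix `A` on `ℂ^d`: `A e_j = e_{j+1 mod d}`. -/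
def shiftMatrix (d : ℕ) : Matrix (Fin d) (Fin d) ℂ :=
  Matrix.of fun i j => if (i : ℕ) = ((j : ℕ) + 1) % d then 1 else 0

/-- The phase matrix `B` on `ℂ^d`: `B e_j = ω^j e_j` with `ω = exp(2iπ/d)`. -/
def phaseMatrix (d : ℕ) : Matrix (Fin d) (Fin d) ℂ :=
  Matrix.diagonal fun j : Fin d => Complex.exp (2 * π * Complex.I / d) ^ (j : ℕ)

theorem shiftMatrix_pow_conj_apply (d : ℕ) [NeZero d] (X : Matrix (Fin d) (Fin d) ℂ) (k : ℕ)
    (a b : Fin d) :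
    (shiftMatrix d ^ k * X * (shiftMatrix d ^ k)ᴴ) a b =
      X (a - Fin.ofNat d k) (b - Fin.ofNat d k) := by
  have shift_apply : ∀ i j : Fin d, shiftMatrix d i j = if i - Fin.ofNat d 1 = j then 1 else 0 := by
    intro i j
    have h : ((i : ℕ) = ((j : ℕ) + 1) % d) ↔ i - Fin.ofNat d 1 = j := by
      rw [sub_eq_iff_eq_add, Fin.ext_iff, Fin.val_add]
      simp
    simp only [shiftMatrix, Matrix.of_apply, h]
  induction k generalizing a b with
  | zero => simp
  | succ k ih =>
    have h : shiftMatrix d ^ (k + 1) * X * (shiftMatrix d ^ (k + 1))ᴴ =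
        shiftMatrix d * (shiftMatrix d ^ k * X * (shiftMatrix d ^ k)ᴴ) * (shiftMatrix d)ᴴ := by
      simp only [pow_succ' _ k, conjTranspose_mul, Matrix.mul_assoc]
    have hk : Fin.ofNat d (k + 1) = Fin.ofNat d 1 + Fin.ofNat d k := by
      ext
      simp [Fin.val_add, add_comm]
    rw [h, hk, ← sub_sub, ← sub_sub, ← ih]
    simp [Matrix.mul_apply (M := _ * _) (N := (shiftMatrix d)ᴴ),
      Matrix.mul_apply (M := shiftMatrix d), shift_apply, apply_ite star]

theorem phaseMatrix_pow_conj_apply (d : ℕ) (X : Matrix (Fin d) (Fin d) ℂ) (j : ℕ) (a b : Fin d) :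
    (phaseMatrix d ^ j * X * (phaseMatrix d ^ j)ᴴ) a b =
      (Complex.exp (2 * π * Complex.I / d) ^ (a : ℕ) *
        star (Complex.exp (2 * π * Complex.I / d) ^ (b : ℕ))) ^ j * X a b := by
  simp only [phaseMatrix, diagonal_pow, diagonal_conjTranspose, mul_diagonal, diagonal_mul,
    Pi.pow_apply, Pi.star_apply, star_pow, mul_pow]
  ring

theorem sum_pow_phase_mul_star (d : ℕ) [NeZero d] (a b : Fin d) :
    ∑ j : Fin d, (Complex.exp (2 * π * Complex.I / d) ^ (a : ℕ) *
        star (Complex.exp (2 * π * Complex.I / d) ^ (b : ℕ))) ^ ((j : ℕ) + 1) =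
      if a = b then (d : ℂ) else 0 := by
  have hω := Complex.isPrimitiveRoot_exp d (NeZero.ne d)
  set ω := Complex.exp (2 * π * Complex.I / d)
  have hnorm : ω * star ω = 1 := by
    have := Complex.norm_eq_one_of_pow_eq_one hω.pow_eq_one (NeZero.ne d)
    rw [Complex.star_def, Complex.mul_conj, Complex.normSq_eq_norm_sq, this]
    simp
  have hb : ω ^ (b : ℕ) * star (ω ^ (b : ℕ)) = 1 := by
    rw [star_pow, ← mul_pow, hnorm, one_pow]
  split_ifs with h
  · subst h
    simp only [hb]
    simp
  · set z := ω ^ (a : ℕ) * star (ω ^ (b : ℕ)) with hz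
    have hz1 : z ≠ 1 := by
      intro hz1
      apply h
      apply Fin.ext
      apply hω.pow_inj a.2 b.2
      calc ω ^ (a : ℕ) = ω ^ (a : ℕ) * (ω ^ (b : ℕ) * star (ω ^ (b : ℕ))) := by rw [hb, mul_one]
        _ = z * ω ^ (b : ℕ) := by rw [hz]; ring
        _ = ω ^ (b : ℕ) := by rw [hz1, one_mul]
    have hzd : z ^ d = 1 := by
      rw [hz, mul_pow, ← star_pow, pow_right_comm ω a d, pow_right_comm ω b d, hω.pow_eq_one]
      simp
    simp only [pow_succ, ← Finset.sum_mul]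
    rw [Fin.sum_univ_eq_sum_range (fun j => z ^ j), geom_sum_eq hz1, hzd]
    simp

theorem sum_sub_ofNat_succ (d : ℕ) [NeZero d] (f : Fin d → ℂ) (a : Fin d) :
    ∑ k : Fin d, f (a - Fin.ofNat d ((k : ℕ) + 1)) = ∑ k, f k := by
  rw [← Equiv.sum_comp ((Equiv.addRight (Fin.ofNat d 1)).trans (Equiv.subLeft a)) f]
  refine Finset.sum_congr rfl fun k _ => ?_
  have : Fin.ofNat d ((k : ℕ) + 1) = k + Fin.ofNat d 1 := by
    ext
    simp [Fin.val_add]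
  rw [this]
  rfl

/-- The unitaries `V_{j,k} = B^j A^k`, `1 ≤ j, k ≤ d`, form a Kraus decomposition of the
completely randomizing channel: `(1/d²) ∑_{j,k} V_{j,k} X V_{j,k}† = (tr X)·Id/d`. -/
theorem fourier_kraus_decomposition (d : ℕ) (hd : 2 ≤ d) (X : Matrix (Fin d) (Fin d) ℂ) :
    ((d : ℂ) ^ 2)⁻¹ •
        ∑ j : Fin d, ∑ k : Fin d,
          (phaseMatrix d ^ ((j : ℕ) + 1) * shiftMatrix d ^ ((k : ℕ) + 1)) * X *
            (phaseMatrix d ^ ((j : ℕ) + 1) * shiftMatrix d ^ ((k : ℕ) + 1))ᴴ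
      = X.trace • ((d : ℂ)⁻¹ • 1) := by
  have : NeZero d := ⟨by omega⟩
  have hd0 : (d : ℂ) ≠ 0 := NeZero.ne _
  ext a b
  have h : ∀ j k : ℕ, ((phaseMatrix d ^ j * shiftMatrix d ^ k) * X *
      (phaseMatrix d ^ j * shiftMatrix d ^ k)ᴴ) a b =
      (Complex.exp (2 * π * Complex.I / d) ^ (a : ℕ) *
        star (Complex.exp (2 * π * Complex.I / d) ^ (b : ℕ))) ^ j *
        X (a - Fin.ofNat d k) (b - Fin.ofNat d k) := by
    intro j k
    rw [← shiftMatrix_pow_conj_apply d X, ← phaseMatrix_pow_conj_apply]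
    simp only [conjTranspose_mul, Matrix.mul_assoc]
  simp only [Matrix.smul_apply, Matrix.sum_apply, h, ← Finset.mul_sum, ← Finset.sum_mul,
    sum_pow_phase_mul_star, smul_eq_mul, Matrix.one_apply]
  split_ifs with hab
  · subst hab
    rw [sum_sub_ofNat_succ d (fun i => X i i), Matrix.trace]
    simp only [Matrix.diag_apply]
    field_simp
  · simp

end
end

section
/- For 1 < p ≤ 2 and all d×d complex matrices A, B: ‖A‖_p² + (p−1)·‖B‖_p² ≤ (1/2)·(‖A+B‖_p² + ‖A−B‖_p²), where ‖·‖_p is the Schatten p-norm. Consequently, the Schatten class S_p^d is 2-convex with constant 1/√(p−1). -/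
open Matrix
open scoped ComplexOrder

noncomputable section

/-- The singular values of a complex matrix: square roots of the eigenvalues of `AᴴA`. -/
def singularValues {d : ℕ} (A : Matrix (Fin d) (Fin d) ℂ) : Fin d → ℝ :=
  fun i => Real.sqrt ((Matrix.posSemidef_conjTranspose_mul_self A).isHermitian.eigenvalues i)

/-- The Schatten `p`-norm of a matrix: `(∑ sᵢ^p)^{1/p}` where the `sᵢ` are the
singular values. -/
def schattenNorm {d : ℕ} (p : ℝ) (A : Matrix (Fin d) (Fin d) ℂ) : ℝ :=
  (∑ i, singularValues A i ^ p) ^ (1 / p)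

/-- Bernoulli's inequality for exponents in `[-1, 0]`. -/
lemma one_add_mul_sub_one_le_rpow {q x : ℝ} (hq1 : -1 ≤ q) (hq0 : q ≤ 0) (hx : 0 < x) :
    1 + q * (x - 1) ≤ x ^ q := by
  have h := rpow_one_add_le_one_add_mul_self (s := x - 1) (by linarith) (p := -q)
    (by linarith) (by linarith)
  rw [add_sub_cancel] at h
  have hpos : 0 < x ^ (-q) := Real.rpow_pos_of_pos hx _
  have hinv : x ^ q = (x ^ (-q))⁻¹ := by rw [Real.rpow_neg hx.le, inv_inv]
  rw [hinv, ← one_div, le_div_iff₀ hpos]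
  by_cases hs : 1 + q * (x - 1) ≤ 0
  · nlinarith
  · nlinarith [sq_nonneg (q * (x - 1))]

/-- The tangent line inequality for `s ↦ s ^ q`, `q ∈ [-1, 0]`. -/
lemma rpow_add_mul_sub_le_rpow {q s m : ℝ} (hq1 : -1 ≤ q) (hq0 : q ≤ 0) (hs : 0 < s)
    (hm : 0 < m) : m ^ q + q * m ^ (q - 1) * (s - m) ≤ s ^ q := by
  have h := one_add_mul_sub_one_le_rpow hq1 hq0 (div_pos hs hm)
  rw [Real.div_rpow hs.le hm.le, le_div_iff₀ (Real.rpow_pos_of_pos hm _)] at h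
  rw [Real.rpow_sub_one hm.ne']
  calc _ = (1 + q * (s / m - 1)) * m ^ q := by field_simp
    _ ≤ _ := h

/-- Lower bound for the Bregman divergence of `s ↦ s ^ p` on the positive half line. -/
lemma bregman_rpow_pos {p a y : ℝ} (hp1 : 1 < p) (hp2 : p ≤ 2) (ha : 0 < a) (hy : 0 < y) :
    p * (p - 1) / 2 * (y - a) ^ 2 * ((y + 2 * a) / 3) ^ (p - 2)
      ≤ y ^ p - a ^ p - p * a ^ (p - 1) * (y - a) := by
  set m := (y + 2 * a) / 3 with hm
  have hmpos : 0 < m := by positivity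
  set c₀ := m ^ (p - 2)
  set c₁ := (p - 2) * m ^ (p - 2 - 1)
  set f : ℝ → ℝ := fun s => s ^ p - p * (p - 1) * (c₀ * (s ^ 2 / 2) + c₁ * ((s - m) ^ 3 / 6))
  set f' : ℝ → ℝ := fun s =>
    p * s ^ (p - 1) - p * (p - 1) * (c₀ * s + c₁ * ((s - m) ^ 2 / 2))
  set f'' : ℝ → ℝ := fun s =>
    p * ((p - 1) * s ^ (p - 2)) - p * (p - 1) * (c₀ + c₁ * (s - m))
  have hf' : ∀ s, 0 < s → HasDerivAt f (f' s) s := by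
    intro s hs
    have h1 := Real.hasDerivAt_rpow_const (x := s) (p := p) (Or.inl hs.ne')
    have h2 := ((hasDerivAt_id s).pow 2).div_const 2
    have h3 := (((hasDerivAt_id s).sub_const m).pow 3).div_const 6
    refine (h1.sub (((h2.const_mul c₀).add (h3.const_mul c₁)).const_mul
      (p * (p - 1)))).congr_deriv ?_
    simp only [f', id]
    push_cast
    ring
  have hf'' : ∀ s, 0 < s → HasDerivAt f' (f'' s) s := by
    intro s hs
    have h1 := (Real.hasDerivAt_rpow_const (x := s) (p := p - 1) (Or.inl hs.ne')).const_mul p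
    have h2 := hasDerivAt_id s
    have h3 := (((hasDerivAt_id s).sub_const m).pow 2).div_const 2
    refine (h1.sub (((h2.const_mul c₀).add (h3.const_mul c₁)).const_mul
      (p * (p - 1)))).congr_deriv ?_
    have : p - 1 - 1 = p - 2 := by ring
    simp [f'', this]
  have hconv : ConvexOn ℝ (Set.Ioi 0) f := by
    refine convexOn_of_hasDerivWithinAt2_nonneg (f' := f') (f'' := f'') (convex_Ioi 0)
      (fun s hs => (hf' s hs).continuousAt.continuousWithinAt) ?_ ?_ ?_
    · intro s hs
      rw [interior_Ioi] at hs
      exact (hf' s hs).hasDerivWithinAt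
    · intro s hs
      rw [interior_Ioi] at hs
      exact (hf'' s hs).hasDerivWithinAt
    · intro s hs
      rw [interior_Ioi] at hs
      have h := rpow_add_mul_sub_le_rpow (q := p - 2) (by linarith) (by linarith) hs hmpos
      have hpp : 0 ≤ p * (p - 1) := by nlinarith
      have := mul_le_mul_of_nonneg_left h hpp
      simp only [f'', c₀, c₁]
      linarith
  have key : f a + f' a * (y - a) ≤ f y := by
    rcases lt_trichotomy a y with h | h | h
    · have := hconv.le_slope_of_hasDerivAt (Set.mem_Ioi.2 ha) (Set.mem_Ioi.2 hy) h (hf' a ha)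
      rw [slope_def_field, le_div_iff₀ (by linarith)] at this
      linarith
    · simp [h]
    · have := hconv.slope_le_of_hasDerivAt (Set.mem_Ioi.2 hy) (Set.mem_Ioi.2 ha) h (hf' a ha)
      rw [slope_def_field, div_le_iff₀ (by linarith)] at this
      linarith
  have e : f y - f a - f' a * (y - a) = y ^ p - a ^ p - p * a ^ (p - 1) * (y - a)
      - p * (p - 1) / 2 * (y - a) ^ 2 * c₀ := by
    simp only [f, f', hm]
    ring
  linarith

/-- Lower bound for the Bregman divergence of `s ↦ s ^ p` on the closed half line. -/
lemma bregman_rpow_nonneg {p a y : ℝ} (hp1 : 1 < p) (hp2 : p ≤ 2) (ha : 0 ≤ a) (hy : 0 ≤ y) :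
    p * (p - 1) / 2 * (y - a) ^ 2 * ((y + 2 * a) / 3) ^ (p - 2)
      ≤ y ^ p - a ^ p - p * a ^ (p - 1) * (y - a) := by
  rcases ha.eq_or_lt with rfl | ha
  · rcases hy.eq_or_lt with rfl | hy
    · simp
    · rw [Real.zero_rpow (by linarith), Real.zero_rpow (by linarith)]
      have h3 : (3 : ℝ) ^ (2 - p) ≤ Real.exp (3 / 2 * (2 - p)) := by
        rw [Real.exp_mul]
        refine Real.rpow_le_rpow (by norm_num) ?_ (by linarith)
        have : Real.exp (3 / 2) = Real.exp 1 * Real.exp (1 / 2) := by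
          rw [← Real.exp_add]; norm_num
        rw [this]
        nlinarith [Real.exp_one_gt_d9, Real.add_one_le_exp (1 / 2 : ℝ)]
      have h1 : p - 1 ≤ Real.exp (-(2 - p)) := by
        have := Real.add_one_le_exp (-(2 - p)); linarith
      have h2 : p / 2 ≤ Real.exp (-((2 - p) / 2)) := by
        have := Real.add_one_le_exp (-((2 - p) / 2)); linarith
      have hmain : p / 2 * (p - 1) * 3 ^ (2 - p) ≤ 1 := by
        calc p / 2 * (p - 1) * 3 ^ (2 - p)
            ≤ Real.exp (-((2 - p) / 2)) * Real.exp (-(2 - p)) * Real.exp (3 / 2 * (2 - p)) := by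
              gcongr
          _ = 1 := by
              rw [← Real.exp_add, ← Real.exp_add, Real.exp_eq_one_iff]; ring
      have e1 : ((y + 2 * 0) / 3) ^ (p - 2) = y ^ (p - 2) * 3 ^ (2 - p) := by
        rw [mul_zero, add_zero, Real.div_rpow hy.le (by norm_num), div_eq_mul_inv,
          ← Real.rpow_neg (by norm_num)]
        congr 2
        ring
      have e2 : y ^ p = y ^ 2 * y ^ (p - 2) := by
        rw [← Real.rpow_natCast, ← Real.rpow_add hy]; congr 1; push_cast; ring
      rw [e1, e2]
      have : 0 ≤ y ^ 2 * y ^ (p - 2) := by positivity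
      nlinarith [mul_le_mul_of_nonneg_left hmain this]
  · rcases hy.eq_or_lt with rfl | hy
    · rw [Real.zero_rpow (by linarith)]
      have h3 : (3 / 2 : ℝ) ^ (2 - p) ≤ 1 + (2 - p) * (1 / 2) := by
        have := rpow_one_add_le_one_add_mul_self (s := 1 / 2) (by norm_num) (p := 2 - p)
          (by linarith) (by linarith)
        norm_num at this ⊢
        linarith
      have e1 : ((0 + 2 * a) / 3) ^ (p - 2) = a ^ (p - 2) * (3 / 2) ^ (2 - p) := by
        have : (0 + 2 * a) / 3 = a / (3 / 2) := by ring
        rw [this, Real.div_rpow ha.le (by norm_num), div_eq_mul_inv,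
          ← Real.rpow_neg (by norm_num)]
        congr 2
        ring
      have e2 : a ^ p = a ^ 2 * a ^ (p - 2) := by
        rw [← Real.rpow_natCast, ← Real.rpow_add ha]; congr 1; push_cast; ring
      have e3 : a ^ (p - 1) = a * a ^ (p - 2) := by
        rw [← Real.rpow_one_add' ha.le (by linarith)]; congr 1; ring
      have hmain : p / 2 * (3 / 2) ^ (2 - p) ≤ 1 := by nlinarith
      have h0 : 0 ≤ (p - 1) * (a ^ 2 * a ^ (p - 2)) :=
        mul_nonneg (by linarith) (by positivity)
      rw [e1, e2, e3]
      nlinarith [mul_le_mul_of_nonneg_left hmain h0]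
    · exact bregman_rpow_pos hp1 hp2 ha hy

/-- Lower bound for the Bregman divergence of `s ↦ |s| ^ p` on the real line. -/
lemma bregman_abs_rpow {p : ℝ} (hp1 : 1 < p) (hp2 : p ≤ 2) (a y : ℝ) :
    p * (p - 1) / 2 * (y - a) ^ 2 * ((|y| + 2 * |a|) / 3) ^ (p - 2)
      ≤ |y| ^ p - |a| ^ p - p * (|a| ^ (p - 2) * a) * (y - a) := by
  have rpow_eq : ∀ x : ℝ, 0 ≤ x → x ^ (p - 2) * x = x ^ (p - 1) := by
    intro x hx
    rw [← Real.rpow_add_one' hx (by linarith)]; congr 1; ring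
  wlog ha : 0 ≤ a generalizing a y
  · have := this (-a) (-y) (by linarith)
    simp only [abs_neg] at this
    linarith
  rw [abs_of_nonneg ha, rpow_eq a ha]
  rcases le_or_gt 0 y with hy | hy
  · rw [abs_of_nonneg hy]
    exact bregman_rpow_nonneg hp1 hp2 ha hy
  · have h := bregman_rpow_nonneg hp1 hp2 ha (abs_nonneg y)
    have hy' : y = -|y| := by rw [abs_of_neg hy]; ring
    set z := |y|
    have hz : 0 < z := by linarith
    rw [hy']
    suffices hs : p * (p - 1) / 2 * (4 * (a * z)) * ((z + 2 * a) / 3) ^ (p - 2)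
        ≤ 2 * (p * (a ^ (p - 1) * z)) by nlinarith
    rcases ha.eq_or_lt with rfl | ha
    · simp [Real.zero_rpow (show p - 1 ≠ 0 by linarith)]
    · have h3 : (3 / 2 : ℝ) ^ (2 - p) ≤ 1 + (2 - p) * (1 / 2) := by
        have := rpow_one_add_le_one_add_mul_self (s := 1 / 2) (by norm_num) (p := 2 - p)
          (by linarith) (by linarith)
        norm_num at this ⊢
        linarith
      have hle : ((z + 2 * a) / 3) ^ (p - 2) ≤ a ^ (p - 2) * (3 / 2) ^ (2 - p) := by
        have : a ^ (p - 2) * (3 / 2) ^ (2 - p) = (a / (3 / 2)) ^ (p - 2) := by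
          rw [Real.div_rpow ha.le (by norm_num), div_eq_mul_inv (a ^ (p - 2)),
            ← Real.rpow_neg (by norm_num)]
          congr 2
          ring
        rw [this]
        exact Real.rpow_le_rpow_of_nonpos (by positivity) (by linarith) (by linarith)
      have hmain : (p - 1) * (3 / 2) ^ (2 - p) ≤ 1 := by nlinarith
      have hcoef : 0 ≤ p * (p - 1) / 2 * (4 * (a * z)) := by
        have : 0 ≤ p - 1 := by linarith
        positivity
      have h0 : 0 ≤ 2 * p * (a * z) * a ^ (p - 2) := by positivity
      rw [← rpow_eq a ha.le]
      nlinarith [mul_le_mul_of_nonneg_left hle hcoef, mul_le_mul_of_nonneg_left hmain h0]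

/-- Comparison of sums of resolvents implies comparison of sums of negative powers. -/
lemma sum_rpow_le_of_sum_div_le {ι κ : Type*} [Fintype ι] [Fintype κ] {c x : ι → ℝ}
    {b z : κ → ℝ} {q : ℝ} (hq : q ∈ Set.Ioo (0 : ℝ) 1) (hx : ∀ i, 0 < x i) (hz : ∀ k, 0 < z k)
    (h : ∀ t, 0 < t → ∑ k, b k / (t + z k) ≤ ∑ i, c i / (t + x i)) :
    ∑ k, b k * z k ^ (q - 1) ≤ ∑ i, c i * x i ^ (q - 1) := by
  set J := ∫ t in Set.Ioi 0, Real.rpowIntegrand₀₁ q t 1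
  have hJ : 0 < J := Real.integral_rpowIntegrand₀₁_one_pos hq
  have hintegrable : ∀ (w v : ℝ), 0 < v → MeasureTheory.IntegrableOn
      (fun t => w / v * Real.rpowIntegrand₀₁ q t v) (Set.Ioi 0) := fun w v hv =>
    (Real.integrableOn_rpowIntegrand₀₁_Ioi hq hv.le).const_mul _
  have hval : ∀ (w v : ℝ), 0 < v →
      ∫ t in Set.Ioi 0, w / v * Real.rpowIntegrand₀₁ q t v = w * v ^ (q - 1) * J := by
    intro w v hv
    rw [MeasureTheory.integral_const_mul, Real.integral_rpowIntegrand₀₁_eq_rpow_mul_const hq hv.le,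
      Real.rpow_sub_one hv.ne']
    ring
  have hpt : ∀ (w v t : ℝ), 0 < v → 0 < t →
      w / v * Real.rpowIntegrand₀₁ q t v = t ^ (q - 1) * (w / (t + v)) := by
    intro w v t hv ht
    rw [Real.rpowIntegrand₀₁_eq_pow_div hq ht.le hv.le]
    field_simp
  have hmono : ∫ t in Set.Ioi 0, ∑ k, b k / z k * Real.rpowIntegrand₀₁ q t (z k)
      ≤ ∫ t in Set.Ioi 0, ∑ i, c i / x i * Real.rpowIntegrand₀₁ q t (x i) := by
    refine MeasureTheory.setIntegral_mono_on
      (MeasureTheory.integrable_finsetSum _ fun k _ => hintegrable _ _ (hz k))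
      (MeasureTheory.integrable_finsetSum _ fun i _ => hintegrable _ _ (hx i)) measurableSet_Ioi ?_
    intro t ht
    rw [Finset.sum_congr rfl fun k _ => hpt (b k) (z k) t (hz k) ht,
      Finset.sum_congr rfl fun i _ => hpt (c i) (x i) t (hx i) ht,
      ← Finset.mul_sum, ← Finset.mul_sum]
    exact mul_le_mul_of_nonneg_left (h t ht) (Real.rpow_nonneg (le_of_lt ht) _)
  rw [MeasureTheory.integral_finsetSum _ fun k _ => hintegrable _ _ (hz k),
    MeasureTheory.integral_finsetSum _ fun i _ => hintegrable _ _ (hx i),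
    Finset.sum_congr rfl fun k _ => hval (b k) (z k) (hz k),
    Finset.sum_congr rfl fun i _ => hval (c i) (x i) (hx i),
    ← Finset.sum_mul, ← Finset.sum_mul] at hmono
  exact le_of_mul_le_mul_right hmono hJ

section Holder

variable {n : Type*} [Fintype n]

/-- A reverse Hölder inequality for weighted sums of squares. -/
lemma rpow_sum_mul_rpow_le_sum_sq_mul {p T : ℝ} (hp1 : 1 < p) (hp2 : p ≤ 2) (b v : n → ℝ)
    (hv : ∀ k, 0 < v k) (hT0 : 0 < T) (hT : ∑ k, v k ^ p ≤ T) :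
    (∑ k, |b k| ^ p) ^ (2 / p) * T ^ ((p - 2) / p) ≤ ∑ k, b k ^ 2 * v k ^ (p - 2) := by
  have hp0 : 0 < p := by linarith
  set F := ∑ k, b k ^ 2 * v k ^ (p - 2)
  set G := ∑ k, v k ^ p
  have hF : 0 ≤ F := Finset.sum_nonneg fun k _ =>
    mul_nonneg (sq_nonneg _) (Real.rpow_nonneg (hv k).le _)
  have hG : 0 ≤ G := Finset.sum_nonneg fun k _ => Real.rpow_nonneg (hv k).le _
  have hB : 0 ≤ ∑ k, |b k| ^ p := Finset.sum_nonneg fun k _ => Real.rpow_nonneg (abs_nonneg _) _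
  have h := Real.inner_le_weight_mul_Lp_of_nonneg Finset.univ (p := 2 / p)
    (by rw [le_div_iff₀ hp0]; linarith) (fun k => v k ^ p) (fun k => |b k| ^ p * v k ^ (-p))
    (fun k => Real.rpow_nonneg (hv k).le _)
    (fun k => mul_nonneg (Real.rpow_nonneg (abs_nonneg _) _) (Real.rpow_nonneg (hv k).le _))
  have e1 : ∀ k, v k ^ p * (|b k| ^ p * v k ^ (-p)) = |b k| ^ p := by
    intro k
    rw [mul_comm, mul_assoc, ← Real.rpow_add (hv k)]
    simp
  have e2 : ∀ k, v k ^ p * (|b k| ^ p * v k ^ (-p)) ^ (2 / p) = b k ^ 2 * v k ^ (p - 2) := by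
    intro k
    rw [Real.mul_rpow (by positivity) (Real.rpow_nonneg (hv k).le _),
      ← Real.rpow_mul (abs_nonneg _), ← Real.rpow_mul (hv k).le]
    have h1 : p * (2 / p) = (2 : ℕ) := by push_cast; field_simp
    have h2 : -p * (2 / p) = -2 := by field_simp
    rw [h1, h2, Real.rpow_natCast, sq_abs, mul_left_comm, ← Real.rpow_add (hv k)]
    congr 1
  simp only [e1, e2] at h
  have h' : (∑ k, |b k| ^ p) ^ (2 / p) ≤ G ^ ((2 - p) / p) * F := by
    calc (∑ k, |b k| ^ p) ^ (2 / p) ≤ (G ^ (1 - (2 / p)⁻¹) * F ^ (2 / p)⁻¹) ^ (2 / p) :=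
          Real.rpow_le_rpow hB h (by positivity)
      _ = G ^ ((2 - p) / p) * F := by
          rw [Real.mul_rpow (Real.rpow_nonneg hG _) (Real.rpow_nonneg hF _),
            ← Real.rpow_mul hG, ← Real.rpow_mul hF, inv_mul_cancel₀ (by positivity),
            Real.rpow_one]
          congr 2
          field_simp
  have h'' : G ^ ((2 - p) / p) ≤ T ^ ((2 - p) / p) :=
    Real.rpow_le_rpow hG hT (div_nonneg (by linarith) hp0.le)
  calc (∑ k, |b k| ^ p) ^ (2 / p) * T ^ ((p - 2) / p)
      ≤ (T ^ ((2 - p) / p) * F) * T ^ ((p - 2) / p) := by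
        gcongr
        exact h'.trans (by gcongr)
    _ = T ^ ((2 - p) / p + (p - 2) / p) * F := by rw [Real.rpow_add hT0]; ring
    _ = F := by
        rw [← add_div]; simp

end Holder

lemma sum_norm_sq_row {n : Type*} [Fintype n] (C : Matrix n n ℂ) (i : n) :
    ((∑ j, ‖C i j‖ ^ 2 : ℝ) : ℂ) = (C * Cᴴ) i i := by
  simp [Matrix.mul_apply, Complex.mul_conj']

section Unitary

variable {n : Type*} [Fintype n] [DecidableEq n]

lemma sum_norm_sq_row_unitary {P : Matrix n n ℂ} (hP : P ∈ unitaryGroup n ℂ) (i : n) :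
    ∑ j, ‖P i j‖ ^ 2 = 1 := by
  have h := sum_norm_sq_row P i
  rw [← star_eq_conjTranspose, mem_unitaryGroup_iff.1 hP, one_apply_eq] at h
  exact_mod_cast h

lemma sum_norm_sq_col_unitary {P : Matrix n n ℂ} (hP : P ∈ unitaryGroup n ℂ) (j : n) :
    ∑ i, ‖P i j‖ ^ 2 = 1 := by
  simpa [star_eq_conjTranspose] using sum_norm_sq_row_unitary (Unitary.star_mem hP) j

lemma conj_diagonal_mul_conjTranspose {P Q : Matrix n n ℂ} (hQ : Q ∈ unitaryGroup n ℂ)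
    (b c : n → ℝ) :
    (P * diagonal (fun k => (b k : ℂ)) * Qᴴ) * (P * diagonal (fun k => (c k : ℂ)) * Qᴴ)ᴴ
      = P * diagonal (fun k => ((b k * c k : ℝ) : ℂ)) * Pᴴ := by
  have hQ' : Qᴴ * Q = 1 := mem_unitaryGroup_iff'.1 hQ
  have hc : (diagonal (fun k => (c k : ℂ)))ᴴ = diagonal (fun k => (c k : ℂ)) := by
    rw [diagonal_conjTranspose]
    congr 1
    ext k
    simp
  rw [conjTranspose_mul, conjTranspose_mul, conjTranspose_conjTranspose, hc]
  calc _ = P * diagonal (fun k => (b k : ℂ)) * (Qᴴ * Q) * diagonal (fun k => (c k : ℂ)) * Pᴴ := by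
        simp only [Matrix.mul_assoc]
    _ = _ := by
        rw [hQ', Matrix.mul_one, Matrix.mul_assoc P, diagonal_mul_diagonal]
        simp

lemma conj_diagonal_apply_self (P : Matrix n n ℂ) (c : n → ℝ) (i : n) :
    (P * diagonal (fun k => (c k : ℂ)) * Pᴴ) i i = ((∑ k, c k * ‖P i k‖ ^ 2 : ℝ) : ℂ) := by
  rw [Matrix.mul_apply]
  push_cast
  refine Finset.sum_congr rfl fun k _ => ?_
  rw [mul_diagonal, conjTranspose_apply, ← Complex.mul_conj']
  simp
  ring

lemma sum_norm_sq_row_conj_diagonal {P Q : Matrix n n ℂ} (hQ : Q ∈ unitaryGroup n ℂ)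
    (c : n → ℝ) (i : n) :
    ∑ j, ‖(P * diagonal (fun k => (c k : ℂ)) * Qᴴ) i j‖ ^ 2 = ∑ k, c k ^ 2 * ‖P i k‖ ^ 2 := by
  have h := sum_norm_sq_row (P * diagonal (fun k => (c k : ℂ)) * Qᴴ) i
  rw [conj_diagonal_mul_conjTranspose hQ, conj_diagonal_apply_self] at h
  simp only [sq]
  simp only [sq] at h
  exact_mod_cast h

lemma sum_norm_sq_col_conj_diagonal {P Q : Matrix n n ℂ} (hP : P ∈ unitaryGroup n ℂ)
    (c : n → ℝ) (j : n) :
    ∑ i, ‖(P * diagonal (fun k => (c k : ℂ)) * Qᴴ) i j‖ ^ 2 = ∑ k, c k ^ 2 * ‖Q j k‖ ^ 2 := by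
  rw [← sum_norm_sq_row_conj_diagonal hP c j]
  refine Finset.sum_congr rfl fun i _ => ?_
  have : Q * diagonal (fun k => (c k : ℂ)) * Pᴴ
      = (P * diagonal (fun k => (c k : ℂ)) * Qᴴ)ᴴ := by
    rw [conjTranspose_mul, conjTranspose_mul, conjTranspose_conjTranspose, diagonal_conjTranspose,
      ← Matrix.mul_assoc]
    congr 3
    ext k
    simp
  rw [this, conjTranspose_apply, norm_star]

lemma sum_re_conj_diagonal_mul_star {P Q : Matrix n n ℂ} (hP : P ∈ unitaryGroup n ℂ)
    (hQ : Q ∈ unitaryGroup n ℂ) (b c : n → ℝ) :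
    ∑ i, ∑ j, ((P * diagonal (fun k => (b k : ℂ)) * Qᴴ) i j
      * star ((P * diagonal (fun k => (c k : ℂ)) * Qᴴ) i j)).re = ∑ k, b k * c k := by
  have h : ∀ i, ∑ j, ((P * diagonal (fun k => (b k : ℂ)) * Qᴴ) i j
      * star ((P * diagonal (fun k => (c k : ℂ)) * Qᴴ) i j)).re
      = ∑ k, (b k * c k) * ‖P i k‖ ^ 2 := by
    intro i
    have h := congrFun (congrFun (conj_diagonal_mul_conjTranspose (P := P) hQ b c) i) i
    rw [conj_diagonal_apply_self, Matrix.mul_apply] at h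
    have h' := congrArg Complex.re h
    rw [Complex.re_sum, Complex.ofReal_re] at h'
    simpa only [conjTranspose_apply] using h'
  simp_rw [h]
  rw [Finset.sum_comm]
  refine Finset.sum_congr rfl fun k _ => ?_
  rw [← Finset.mul_sum, sum_norm_sq_col_unitary hP, mul_one]

/-- Compressing a positive diagonal operator on matrix space to the span of the rank one operators
given by the columns of `P` and `Q` decreases its resolvents. -/
lemma sum_sq_div_le_sum_norm_sq_div {P Q : Matrix n n ℂ} (hP : P ∈ unitaryGroup n ℂ)
    (hQ : Q ∈ unitaryGroup n ℂ) (b : n → ℝ) {y a : n → ℝ} (hy : ∀ i, 0 ≤ y i)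
    (ha : ∀ j, 0 ≤ a j) {t : ℝ} (ht : 0 < t) :
    ∑ k, b k ^ 2 / (t + ((∑ i, y i * ‖P i k‖ ^ 2) + 2 * ∑ j, a j * ‖Q j k‖ ^ 2) / 3)
      ≤ ∑ i, ∑ j, ‖(P * diagonal (fun k => (b k : ℂ)) * Qᴴ) i j‖ ^ 2
          / (t + (y i + 2 * a j) / 3) := by
  set u : n → ℝ := fun k => ((∑ i, y i * ‖P i k‖ ^ 2) + 2 * ∑ j, a j * ‖Q j k‖ ^ 2) / 3 with hu
  have hu0 : ∀ k, 0 ≤ u k := fun k => by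
    have h1 : 0 ≤ ∑ i, y i * ‖P i k‖ ^ 2 := Finset.sum_nonneg fun i _ =>
      mul_nonneg (hy i) (sq_nonneg _)
    have h2 : 0 ≤ ∑ j, a j * ‖Q j k‖ ^ 2 := Finset.sum_nonneg fun i _ =>
      mul_nonneg (ha i) (sq_nonneg _)
    simp only [hu]
    positivity
  set c : n → ℝ := fun k => b k / (t + u k) with hc
  set N := P * diagonal (fun k => (b k : ℂ)) * Qᴴ
  set C := P * diagonal (fun k => (c k : ℂ)) * Qᴴ
  have hpt : ∀ i j, 2 * (N i j * star (C i j)).re - (t + (y i + 2 * a j) / 3) * ‖C i j‖ ^ 2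
      ≤ ‖N i j‖ ^ 2 / (t + (y i + 2 * a j) / 3) := by
    intro i j
    have hw : 0 < t + (y i + 2 * a j) / 3 := by
      have := hy i
      have := ha j
      positivity
    set w := t + (y i + 2 * a j) / 3
    have hre : (N i j * star (C i j)).re ≤ ‖N i j‖ * ‖C i j‖ := by
      refine (Complex.re_le_norm _).trans ?_
      rw [norm_mul, norm_star]
    rw [le_div_iff₀ hw]
    nlinarith [sq_nonneg (‖N i j‖ - w * ‖C i j‖)]
  have hNC : ∑ i, ∑ j, (N i j * star (C i j)).re = ∑ k, b k * c k :=
    sum_re_conj_diagonal_mul_star hP hQ b c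
  have hCy : ∑ i, ∑ j, y i * ‖C i j‖ ^ 2 = ∑ k, c k ^ 2 * ∑ i, y i * ‖P i k‖ ^ 2 := by
    simp_rw [← Finset.mul_sum, C, sum_norm_sq_row_conj_diagonal hQ, Finset.mul_sum]
    rw [Finset.sum_comm]
    exact Finset.sum_congr rfl fun _ _ => Finset.sum_congr rfl fun _ _ => by ring
  have hCa : ∑ i, ∑ j, a j * ‖C i j‖ ^ 2 = ∑ k, c k ^ 2 * ∑ j, a j * ‖Q j k‖ ^ 2 := by
    rw [Finset.sum_comm]
    simp_rw [← Finset.mul_sum, C, sum_norm_sq_col_conj_diagonal hP, Finset.mul_sum]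
    rw [Finset.sum_comm]
    exact Finset.sum_congr rfl fun _ _ => Finset.sum_congr rfl fun _ _ => by ring
  have hC1 : ∑ i, ∑ j, ‖C i j‖ ^ 2 = ∑ k, c k ^ 2 := by
    simp_rw [C, sum_norm_sq_row_conj_diagonal hQ]
    rw [Finset.sum_comm]
    simp_rw [← Finset.mul_sum, sum_norm_sq_col_unitary hP, mul_one]
  calc ∑ k, b k ^ 2 / (t + u k)
      = 2 * (∑ k, b k * c k) - (t * (∑ k, c k ^ 2)
          + ((∑ k, c k ^ 2 * ∑ i, y i * ‖P i k‖ ^ 2)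
            + 2 * ∑ k, c k ^ 2 * ∑ j, a j * ‖Q j k‖ ^ 2) / 3) := by
        simp only [Finset.mul_sum (s := Finset.univ) (f := fun k => b k * c k),
          Finset.mul_sum (s := Finset.univ) (f := fun k => c k ^ 2),
          Finset.mul_sum (s := Finset.univ) (f := fun k => c k ^ 2 * ∑ j, a j * ‖Q j k‖ ^ 2)]
        rw [← Finset.sum_add_distrib, Finset.sum_div, ← Finset.sum_add_distrib,
          ← Finset.sum_sub_distrib]
        refine Finset.sum_congr rfl fun k _ => ?_
        have : 0 < t + u k := by linarith [hu0 k]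
        have hbc : b k = c k * (t + u k) := by simp only [hc]; field_simp
        have e : b k ^ 2 / (t + u k) = c k ^ 2 * (t + u k) := by rw [hbc]; field_simp
        rw [e, hbc]
        simp only [hu]
        ring
    _ = ∑ i, ∑ j, (2 * (N i j * star (C i j)).re
          - (t + (y i + 2 * a j) / 3) * ‖C i j‖ ^ 2) := by
        rw [← hNC, ← hCy, ← hCa, ← hC1]
        simp only [Finset.mul_sum, Finset.sum_div, ← Finset.sum_add_distrib,
          ← Finset.sum_sub_distrib]
        exact Finset.sum_congr rfl fun _ _ => Finset.sum_congr rfl fun _ _ => by ring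
    _ ≤ _ := Finset.sum_le_sum fun i _ => Finset.sum_le_sum fun j _ => hpt i j

lemma sum_sq_mul_rpow_le_sum_norm_sq_mul_rpow {P Q : Matrix n n ℂ} (hP : P ∈ unitaryGroup n ℂ)
    (hQ : Q ∈ unitaryGroup n ℂ) (b : n → ℝ) {y a : n → ℝ} (hy : ∀ i, 0 ≤ y i)
    (ha : ∀ j, 0 ≤ a j) {p ε : ℝ} (hp1 : 1 < p) (hp2 : p ≤ 2) (hε : 0 < ε) :
    ∑ k, b k ^ 2 * (((∑ i, y i * ‖P i k‖ ^ 2) + 2 * ∑ j, a j * ‖Q j k‖ ^ 2) / 3 + ε) ^ (p - 2)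
      ≤ ∑ i, ∑ j, ‖(P * diagonal (fun k => (b k : ℂ)) * Qᴴ) i j‖ ^ 2
          * ((y i + 2 * a j) / 3 + ε) ^ (p - 2) := by
  rcases hp2.eq_or_lt with rfl | hp2
  · simp only [sub_self, Real.rpow_zero, mul_one]
    simp_rw [sum_norm_sq_row_conj_diagonal hQ]
    rw [Finset.sum_comm]
    simp_rw [← Finset.mul_sum, sum_norm_sq_col_unitary hP, mul_one]
    exact le_rfl
  · have hp : p - 2 = (p - 1) - 1 := by ring
    rw [hp, ← Fintype.sum_prod_type' (fun i j =>
      ‖(P * diagonal (fun k => (b k : ℂ)) * Qᴴ) i j‖ ^ 2 * ((y i + 2 * a j) / 3 + ε) ^ (p - 1 - 1))]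
    refine sum_rpow_le_of_sum_div_le (q := p - 1) ⟨by linarith, by linarith⟩ ?_ ?_ ?_
    · intro x
      have := hy x.1
      have := ha x.2
      positivity
    · intro k
      have h1 : 0 ≤ ∑ i, y i * ‖P i k‖ ^ 2 := Finset.sum_nonneg fun i _ =>
        mul_nonneg (hy i) (sq_nonneg _)
      have h2 : 0 ≤ ∑ j, a j * ‖Q j k‖ ^ 2 := Finset.sum_nonneg fun i _ =>
        mul_nonneg (ha i) (sq_nonneg _)
      positivity
    · intro t ht
      rw [Fintype.sum_prod_type' (fun i j => ‖(P * diagonal (fun k => (b k : ℂ)) * Qᴴ) i j‖ ^ 2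
        / (t + ((y i + 2 * a j) / 3 + ε)))]
      have h := sum_sq_div_le_sum_norm_sq_div hP hQ b hy ha (add_pos ht hε)
      have e : ∀ x, t + (x + ε) = t + ε + x := fun x => by ring
      simpa only [e] using h

lemma sum_rpow_weighted_le {P Q : Matrix n n ℂ} (hP : P ∈ unitaryGroup n ℂ)
    (hQ : Q ∈ unitaryGroup n ℂ) {y a : n → ℝ} (hy : ∀ i, 0 ≤ y i) (ha : ∀ j, 0 ≤ a j)
    {p : ℝ} (hp1 : 1 ≤ p) :
    ∑ k, (((∑ i, y i * ‖P i k‖ ^ 2) + 2 * ∑ j, a j * ‖Q j k‖ ^ 2) / 3) ^ p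
      ≤ ((∑ i, y i ^ p) + 2 * ∑ j, a j ^ p) / 3 := by
  have jensen : ∀ {U : Matrix n n ℂ}, U ∈ unitaryGroup n ℂ → ∀ {z : n → ℝ}, (∀ i, 0 ≤ z i) →
      ∀ k, (∑ i, z i * ‖U i k‖ ^ 2) ^ p ≤ ∑ i, z i ^ p * ‖U i k‖ ^ 2 := by
    intro U hU z hz k
    have := Real.rpow_arith_mean_le_arith_mean_rpow Finset.univ (fun i => ‖U i k‖ ^ 2) z
      (fun i _ => sq_nonneg _) (sum_norm_sq_col_unitary hU k) (fun i _ => hz i) hp1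
    simpa only [mul_comm] using this
  have total : ∀ {U : Matrix n n ℂ}, U ∈ unitaryGroup n ℂ → ∀ (z : n → ℝ),
      ∑ k, ∑ i, z i * ‖U i k‖ ^ 2 = ∑ i, z i := by
    intro U hU z
    rw [Finset.sum_comm]
    simp_rw [← Finset.mul_sum, sum_norm_sq_row_unitary hU, mul_one]
  rw [← total hP (fun i => y i ^ p), ← total hQ (fun i => a i ^ p), Finset.mul_sum,
    ← Finset.sum_add_distrib, Finset.sum_div]
  refine Finset.sum_le_sum fun k _ => ?_
  have h1 : 0 ≤ ∑ i, y i * ‖P i k‖ ^ 2 := Finset.sum_nonneg fun i _ =>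
    mul_nonneg (hy i) (sq_nonneg _)
  have h2 : 0 ≤ ∑ j, a j * ‖Q j k‖ ^ 2 := Finset.sum_nonneg fun i _ =>
    mul_nonneg (ha i) (sq_nonneg _)
  have hconv := (convexOn_rpow hp1).2 (Set.mem_Ici.2 h1) (Set.mem_Ici.2 h2)
    (show (0 : ℝ) ≤ 1 / 3 by norm_num) (show (0 : ℝ) ≤ 2 / 3 by norm_num) (by norm_num)
  simp only [smul_eq_mul] at hconv
  have e : ((∑ i, y i * ‖P i k‖ ^ 2) + 2 * ∑ j, a j * ‖Q j k‖ ^ 2) / 3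
      = 1 / 3 * (∑ i, y i * ‖P i k‖ ^ 2) + 2 / 3 * ∑ j, a j * ‖Q j k‖ ^ 2 := by ring
  rw [e]
  linarith [jensen hP hy k, jensen hQ ha k]

/-- Expansion of a trace Bregman divergence in two eigenbases. -/
lemma bregman_sum_eq {P Q : Matrix n n ℂ} (hP : P ∈ unitaryGroup n ℂ)
    (hQ : Q ∈ unitaryGroup n ℂ) {y a b : n → ℝ}
    (h : ∀ i j, ((y i - a j : ℝ) : ℂ) * (P * Qᴴ) i j
      = (P * diagonal (fun k => (b k : ℂ)) * Qᴴ) i j) (F G H : n → ℝ) :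
    ∑ i, ∑ j, ‖(P * Qᴴ) i j‖ ^ 2 * (F i - G j - H j * (y i - a j))
      = ∑ i, F i - ∑ j, G j - ∑ j, H j * ∑ k, b k * ‖Q j k‖ ^ 2 := by
  have hW : P * Qᴴ ∈ unitaryGroup n ℂ := mul_mem hP (Unitary.star_mem hQ)
  have hP' : Pᴴ * P = 1 := mem_unitaryGroup_iff'.1 hP
  have hrow : ∀ j, ∑ i, ‖(P * Qᴴ) i j‖ ^ 2 * (y i - a j) = ∑ k, b k * ‖Q j k‖ ^ 2 := by
    intro j
    have e : (P * Qᴴ)ᴴ * (P * diagonal (fun k => (b k : ℂ)) * Qᴴ)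
        = Q * diagonal (fun k => (b k : ℂ)) * Qᴴ := by
      rw [conjTranspose_mul, conjTranspose_conjTranspose]
      calc _ = Q * (Pᴴ * P) * diagonal (fun k => (b k : ℂ)) * Qᴴ := by
            simp only [Matrix.mul_assoc]
        _ = _ := by rw [hP', Matrix.mul_one]
    have e' := congrFun (congrFun e j) j
    rw [conj_diagonal_apply_self, Matrix.mul_apply] at e'
    have : ((∑ i, ‖(P * Qᴴ) i j‖ ^ 2 * (y i - a j) : ℝ) : ℂ)
        = ((∑ k, b k * ‖Q j k‖ ^ 2 : ℝ) : ℂ) := by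
      rw [← e', Complex.ofReal_sum]
      refine Finset.sum_congr rfl fun i _ => ?_
      rw [← h, conjTranspose_apply, mul_left_comm]
      have hn : star ((P * Qᴴ) i j) * (P * Qᴴ) i j = ((‖(P * Qᴴ) i j‖ ^ 2 : ℝ) : ℂ) := by
        rw [Complex.ofReal_pow, ← Complex.conj_mul']
        rfl
      rw [hn]
      push_cast
      ring
    exact_mod_cast this
  have hF : ∑ i, ∑ j, ‖(P * Qᴴ) i j‖ ^ 2 * F i = ∑ i, F i := by
    simp_rw [← Finset.sum_mul, sum_norm_sq_row_unitary hW, one_mul]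
  have hG : ∑ i, ∑ j, ‖(P * Qᴴ) i j‖ ^ 2 * G j = ∑ j, G j := by
    rw [Finset.sum_comm]
    simp_rw [← Finset.sum_mul, sum_norm_sq_col_unitary hW, one_mul]
  have hH : ∑ i, ∑ j, H j * (‖(P * Qᴴ) i j‖ ^ 2 * (y i - a j))
      = ∑ j, H j * ∑ k, b k * ‖Q j k‖ ^ 2 := by
    rw [Finset.sum_comm]
    simp_rw [← Finset.mul_sum, hrow]
  rw [← hF, ← hG, ← hH]
  simp only [← Finset.sum_sub_distrib]
  exact Finset.sum_congr rfl fun _ _ => Finset.sum_congr rfl fun _ _ => by ring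

/-- Strong convexity of the trace function `X ↦ Tr |X| ^ p` in spectral coordinates. -/
lemma bregman_trace_rpow {P Q : Matrix n n ℂ} (hP : P ∈ unitaryGroup n ℂ)
    (hQ : Q ∈ unitaryGroup n ℂ) {y a b : n → ℝ} {p T : ℝ} (hp1 : 1 < p) (hp2 : p ≤ 2)
    (h : ∀ i j, ((y i - a j : ℝ) : ℂ) * (P * Qᴴ) i j
      = (P * diagonal (fun k => (b k : ℂ)) * Qᴴ) i j)
    (hT : ((∑ i, |y i| ^ p) + 2 * ∑ j, |a j| ^ p) / 3 < T) :
    p * (p - 1) / 2 * ((∑ k, |b k| ^ p) ^ (2 / p) * T ^ ((p - 2) / p))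
      ≤ ∑ i, |y i| ^ p - ∑ j, |a j| ^ p
        - ∑ j, p * (|a j| ^ (p - 2) * a j) * ∑ k, b k * ‖Q j k‖ ^ 2 := by
  set m : n → ℝ := fun k =>
    ((∑ i, |y i| * ‖P i k‖ ^ 2) + 2 * ∑ j, |a j| * ‖Q j k‖ ^ 2) / 3 with hm
  have hm0 : ∀ k, 0 ≤ m k := fun k => by
    have h1 : 0 ≤ ∑ i, |y i| * ‖P i k‖ ^ 2 := Finset.sum_nonneg fun i _ => by positivity
    have h2 : 0 ≤ ∑ j, |a j| * ‖Q j k‖ ^ 2 := Finset.sum_nonneg fun i _ => by positivity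
    simp only [hm]
    positivity
  have hmT : ∑ k, m k ^ p < T := lt_of_le_of_lt (sum_rpow_weighted_le hP hQ
    (fun i => abs_nonneg (y i)) (fun j => abs_nonneg (a j)) hp1.le) hT
  have hT0 : 0 < T := lt_of_le_of_lt
    (Finset.sum_nonneg fun k _ => Real.rpow_nonneg (hm0 k) p) hmT
  obtain ⟨ε, hεT, hε⟩ : ∃ ε, ∑ k, (m k + ε) ^ p < T ∧ 0 < ε := by
    have hcont : Continuous fun ε : ℝ => ∑ k, (m k + ε) ^ p :=
      continuous_finsetSum _ fun k _ =>
        (continuous_const.add continuous_id).rpow_const fun _ => Or.inr (by linarith)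
    have hev : ∀ᶠ ε in nhds (0 : ℝ), ∑ k, (m k + ε) ^ p < T :=
      hcont.continuousAt.eventually_lt continuousAt_const (by simpa using hmT)
    exact ((hev.filter_mono nhdsWithin_le_nhds).and
      (self_mem_nhdsWithin : Set.Ioi (0 : ℝ) ∈ nhdsWithin 0 (Set.Ioi 0))).exists
  have hpp : 0 ≤ p * (p - 1) / 2 := by
    have : 0 ≤ p - 1 := by linarith
    positivity
  set N := P * diagonal (fun k => (b k : ℂ)) * Qᴴ with hN
  have hNW : ∀ i j, ‖N i j‖ ^ 2 = (y i - a j) ^ 2 * ‖(P * Qᴴ) i j‖ ^ 2 := by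
    intro i j
    rw [← h i j, norm_mul, Complex.norm_real, mul_pow, Real.norm_eq_abs, sq_abs]
  have hpt : ∀ i j, p * (p - 1) / 2 * (‖N i j‖ ^ 2 * ((|y i| + 2 * |a j|) / 3 + ε) ^ (p - 2))
      ≤ ‖(P * Qᴴ) i j‖ ^ 2
        * (|y i| ^ p - |a j| ^ p - p * (|a j| ^ (p - 2) * a j) * (y i - a j)) := by
    intro i j
    have h1 := mul_le_mul_of_nonneg_left (bregman_abs_rpow hp1 hp2 (a j) (y i))
      (sq_nonneg ‖(P * Qᴴ) i j‖)
    refine le_trans ?_ h1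
    rw [hNW]
    rcases (show 0 ≤ (|y i| + 2 * |a j|) / 3 by positivity).eq_or_lt with h0 | h0
    · have hy0 : y i = 0 := by
        have := abs_nonneg (y i); have := abs_nonneg (a j)
        exact abs_eq_zero.1 (by linarith)
      have ha0 : a j = 0 := by
        have := abs_nonneg (y i); have := abs_nonneg (a j)
        exact abs_eq_zero.1 (by linarith)
      simp [hy0, ha0]
    · have : ((|y i| + 2 * |a j|) / 3 + ε) ^ (p - 2) ≤ ((|y i| + 2 * |a j|) / 3) ^ (p - 2) :=
        Real.rpow_le_rpow_of_nonpos h0 (by linarith) (by linarith)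
      calc _ = p * (p - 1) / 2 * ((y i - a j) ^ 2 * ‖(P * Qᴴ) i j‖ ^ 2)
            * ((|y i| + 2 * |a j|) / 3 + ε) ^ (p - 2) := by ring
        _ ≤ p * (p - 1) / 2 * ((y i - a j) ^ 2 * ‖(P * Qᴴ) i j‖ ^ 2)
            * ((|y i| + 2 * |a j|) / 3) ^ (p - 2) := by gcongr
        _ = _ := by ring
  rw [← bregman_sum_eq hP hQ h]
  calc _ ≤ p * (p - 1) / 2 * ∑ k, b k ^ 2 * (m k + ε) ^ (p - 2) :=
        mul_le_mul_of_nonneg_left (rpow_sum_mul_rpow_le_sum_sq_mul hp1 hp2 b _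
          (fun k => by linarith [hm0 k]) hT0 hεT.le) hpp
    _ ≤ p * (p - 1) / 2 * ∑ i, ∑ j, ‖N i j‖ ^ 2 * ((|y i| + 2 * |a j|) / 3 + ε) ^ (p - 2) :=
        mul_le_mul_of_nonneg_left (sum_sq_mul_rpow_le_sum_norm_sq_mul_rpow hP hQ b
          (fun i => abs_nonneg (y i)) (fun j => abs_nonneg (a j)) hp1 hp2 hε) hpp
    _ ≤ _ := by
        simp only [Finset.mul_sum (s := Finset.univ) (a := p * (p - 1) / 2)]
        exact Finset.sum_le_sum fun i _ => Finset.sum_le_sum fun j _ => hpt i j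

/-- The trace of `|A| ^ p` for a Hermitian matrix `A`. -/
def traceAbsRpow (p : ℝ) {A : Matrix n n ℂ} (hA : A.IsHermitian) : ℝ :=
  ∑ i, |hA.eigenvalues i| ^ p

lemma traceAbsRpow_nonneg (p : ℝ) {A : Matrix n n ℂ} (hA : A.IsHermitian) :
    0 ≤ traceAbsRpow p hA :=
  Finset.sum_nonneg fun _ _ => Real.rpow_nonneg (abs_nonneg _) _

lemma eq_zero_of_traceAbsRpow_eq_zero {p : ℝ} {A : Matrix n n ℂ} (hA : A.IsHermitian)
    (hp : p ≠ 0) (h : traceAbsRpow p hA = 0) : A = 0 := by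
  rw [← hA.eigenvalues_eq_zero_iff]
  rw [traceAbsRpow, Finset.sum_eq_zero_iff_of_nonneg
    fun _ _ => Real.rpow_nonneg (abs_nonneg _) _] at h
  ext i
  have := h i (Finset.mem_univ i)
  rw [Real.rpow_eq_zero (abs_nonneg _) hp] at this
  exact abs_eq_zero.1 this

lemma exists_unitary_conj_diagonal_eigenvalues {A : Matrix n n ℂ} (hA : A.IsHermitian) :
    ∃ U ∈ unitaryGroup n ℂ, A = U * diagonal (fun k => (hA.eigenvalues k : ℂ)) * Uᴴ :=
  ⟨hA.eigenvectorUnitary, hA.eigenvectorUnitary.2, by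
    conv_lhs => rw [hA.spectral_theorem, Unitary.conjStarAlgAut_apply]
    rfl⟩

open Polynomial in
lemma charpoly_conj_diagonal {U : Matrix n n ℂ} (hU : U ∈ unitaryGroup n ℂ) (a : n → ℝ) :
    (U * diagonal (fun k => (a k : ℂ)) * Uᴴ).charpoly = ∏ i, (X - C (a i : ℂ)) := by
  have hU' : Uᴴ * U = 1 := mem_unitaryGroup_iff'.1 hU
  rw [charpoly_mul_comm, ← Matrix.mul_assoc, hU', Matrix.one_mul, charpoly_diagonal]

open Polynomial in
lemma sum_map_roots_prod_X_sub_C {ι : Type*} [Fintype ι] (a : ι → ℝ) (f : ℝ → ℝ) :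
    ((∏ i, (X - C (a i : ℂ))).roots.map fun z : ℂ => f z.re).sum = ∑ i, f (a i) := by
  rw [roots_prod _ _ (Finset.prod_ne_zero_iff.2 fun i _ => X_sub_C_ne_zero _)]
  simp only [roots_X_sub_C, Multiset.bind_singleton, Multiset.map_map, Function.comp_def,
    Complex.ofReal_re]
  rfl

open Polynomial in
lemma sum_eq_sum_of_prod_X_sub_C_eq {ι κ : Type*} [Fintype ι] [Fintype κ] {a : ι → ℝ}
    {b : κ → ℝ} (h : ∏ i, (X - C (a i : ℂ)) = ∏ k, (X - C (b k : ℂ))) (f : ℝ → ℝ) :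
    ∑ i, f (a i) = ∑ k, f (b k) := by
  rw [← sum_map_roots_prod_X_sub_C a, ← sum_map_roots_prod_X_sub_C b, h]

lemma traceAbsRpow_smul (p : ℝ) {A B : Matrix n n ℂ} (hA : A.IsHermitian) (hB : B.IsHermitian)
    (c : ℝ) (h : B = (c : ℂ) • A) : traceAbsRpow p hB = |c| ^ p * traceAbsRpow p hA := by
  obtain ⟨U, hU, hUA⟩ := exists_unitary_conj_diagonal_eigenvalues hA
  have hB' : B = U * diagonal (fun k => ((c * hA.eigenvalues k : ℝ) : ℂ)) * Uᴴ := by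
    rw [h]
    conv_lhs => rw [hUA]
    rw [← Matrix.smul_mul, ← Matrix.mul_smul, ← diagonal_smul]
    congr 3
    ext k
    simp
  have hchar := hB.charpoly_eq
  conv_lhs at hchar => rw [hB']
  rw [charpoly_conj_diagonal hU] at hchar
  have hs := sum_eq_sum_of_prod_X_sub_C_eq hchar (fun x => |x| ^ p)
  rw [traceAbsRpow, traceAbsRpow, Finset.mul_sum]
  refine hs.symm.trans (Finset.sum_congr rfl fun k _ => ?_)
  rw [abs_mul, Real.mul_rpow (abs_nonneg _) (abs_nonneg _)]

/-- Strong convexity of `X ↦ Tr |X| ^ p` on Hermitian matrices, in first order form. -/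
lemma exists_subgradient_traceAbsRpow {A : Matrix n n ℂ} (hA : A.IsHermitian) {p : ℝ}
    (hp1 : 1 < p) (hp2 : p ≤ 2) :
    ∃ G : Matrix n n ℂ, ∀ (D Y : Matrix n n ℂ) (hD : D.IsHermitian) (hY : Y.IsHermitian),
      Y = A + D → ∀ T, (traceAbsRpow p hY + 2 * traceAbsRpow p hA) / 3 < T →
      traceAbsRpow p hA + (G * D).trace.re
        + p * (p - 1) / 2 * (traceAbsRpow p hD ^ (2 / p) * T ^ ((p - 2) / p))
          ≤ traceAbsRpow p hY := by
  obtain ⟨V, hV, hVA⟩ := exists_unitary_conj_diagonal_eigenvalues hA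
  set a := hA.eigenvalues with ha
  set g : n → ℝ := fun j => p * (|a j| ^ (p - 2) * a j) with hg
  refine ⟨V * diagonal (fun k => (g k : ℂ)) * Vᴴ, fun D Y hD hY hYAD T hT => ?_⟩
  obtain ⟨U, hU, hUY⟩ := exists_unitary_conj_diagonal_eigenvalues hY
  obtain ⟨E, hE, hED⟩ := exists_unitary_conj_diagonal_eigenvalues hD
  set y := hY.eigenvalues with hy
  set b := hD.eigenvalues with hb
  have hP : Uᴴ * E ∈ unitaryGroup n ℂ := mul_mem (Unitary.star_mem hU) hE
  have hQ : Vᴴ * E ∈ unitaryGroup n ℂ := mul_mem (Unitary.star_mem hV) hE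
  have hUU : Uᴴ * U = 1 := mem_unitaryGroup_iff'.1 hU
  have hVV : Vᴴ * V = 1 := mem_unitaryGroup_iff'.1 hV
  have hEE : E * Eᴴ = 1 := mem_unitaryGroup_iff.1 hE
  have hW : (Uᴴ * E) * (Vᴴ * E)ᴴ = Uᴴ * V := by
    rw [conjTranspose_mul, conjTranspose_conjTranspose]
    calc _ = Uᴴ * (E * Eᴴ) * V := by simp only [Matrix.mul_assoc]
      _ = _ := by rw [hEE, Matrix.mul_one]
  have hN : (Uᴴ * E) * diagonal (fun k => (b k : ℂ)) * (Vᴴ * E)ᴴ = Uᴴ * D * V := by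
    rw [conjTranspose_mul, conjTranspose_conjTranspose]
    conv_rhs => rw [hED]
    simp only [Matrix.mul_assoc]
  have hQD : (Vᴴ * E) * diagonal (fun k => (b k : ℂ)) * (Vᴴ * E)ᴴ = Vᴴ * D * V := by
    rw [conjTranspose_mul, conjTranspose_conjTranspose]
    conv_rhs => rw [hED]
    simp only [Matrix.mul_assoc]
  have hUY' : Uᴴ * Y = diagonal (fun k => (y k : ℂ)) * Uᴴ := by
    conv_lhs => rw [hUY]
    rw [← Matrix.mul_assoc, ← Matrix.mul_assoc, hUU, Matrix.one_mul]
  have hVA' : A * V = V * diagonal (fun k => (a k : ℂ)) := by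
    conv_lhs => rw [hVA]
    rw [Matrix.mul_assoc, hVV, Matrix.mul_one]
  have hrel : ∀ i j, ((y i - a j : ℝ) : ℂ) * ((Uᴴ * E) * (Vᴴ * E)ᴴ) i j
      = ((Uᴴ * E) * diagonal (fun k => (b k : ℂ)) * (Vᴴ * E)ᴴ) i j := by
    intro i j
    have hDe : D = Y - A := by rw [hYAD]; abel
    have : Uᴴ * D * V = diagonal (fun k => (y k : ℂ)) * (Uᴴ * V)
        - (Uᴴ * V) * diagonal (fun k => (a k : ℂ)) := by
      rw [hDe, Matrix.mul_sub, Matrix.sub_mul, hUY', Matrix.mul_assoc Uᴴ A V, hVA']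
      simp only [Matrix.mul_assoc]
    rw [hN, hW, this, Matrix.sub_apply, diagonal_mul, mul_diagonal]
    push_cast
    ring
  have htr : (V * diagonal (fun k => (g k : ℂ)) * Vᴴ * D).trace.re
      = ∑ j, g j * ∑ k, b k * ‖(Vᴴ * E) j k‖ ^ 2 := by
    have : (V * diagonal (fun k => (g k : ℂ)) * Vᴴ * D).trace
        = (diagonal (fun k => (g k : ℂ)) * (Vᴴ * D * V)).trace := by
      simp only [Matrix.mul_assoc]
      rw [Matrix.trace_mul_comm]
      simp only [Matrix.mul_assoc]
    rw [this, ← hQD, Matrix.trace, Complex.re_sum]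
    refine Finset.sum_congr rfl fun j _ => ?_
    rw [diag_apply, diagonal_mul, conj_diagonal_apply_self, ← Complex.ofReal_mul,
      Complex.ofReal_re]
  have h := bregman_trace_rpow hP hQ hp1 hp2 hrel hT
  rw [htr]
  simp only [traceAbsRpow]
  linarith

end Unitary

section Dilation

variable {n : Type*}

lemma isHermitian_dilation (A : Matrix n n ℂ) : (fromBlocks 0 A Aᴴ 0).IsHermitian := by
  rw [Matrix.IsHermitian, fromBlocks_conjTranspose]
  simp

/-- The Hermitian dilation of `A` has the eigenvalues `±sᵢ`, where `sᵢ` are the singular values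
of `A`. -/
lemma traceAbsRpow_dilation {d : ℕ} (p : ℝ) (A : Matrix (Fin d) (Fin d) ℂ) :
    traceAbsRpow p (isHermitian_dilation A) = 2 * ∑ i, singularValues A i ^ p := by
  set H := fromBlocks 0 A Aᴴ 0
  have hH : H.IsHermitian := isHermitian_dilation A
  obtain ⟨U, hU, hUH⟩ := exists_unitary_conj_diagonal_eigenvalues hH
  set hS := (Matrix.posSemidef_conjTranspose_mul_self A).isHermitian
  have hsq : H * H = U * diagonal (fun k => ((hH.eigenvalues k * hH.eigenvalues k : ℝ) : ℂ))
      * Uᴴ := by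
    rw [← conj_diagonal_mul_conjTranspose hU, ← hUH, hH.eq]
  have hchar : (H * H).charpoly = (Aᴴ * A).charpoly * (Aᴴ * A).charpoly := by
    have : H * H = fromBlocks (A * Aᴴ) 0 0 (Aᴴ * A) := by
      simp [H, fromBlocks_multiply]
    rw [this, charpoly_fromBlocks_zero₁₂, charpoly_mul_comm A]
  rw [hsq, charpoly_conj_diagonal hU, hS.charpoly_eq] at hchar
  have hs := sum_eq_sum_of_prod_X_sub_C_eq (b := Sum.elim hS.eigenvalues hS.eigenvalues)
    (hchar.trans (by simp [Fintype.prod_sum_type])) (fun x => Real.sqrt x ^ p)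
  simp only [Real.sqrt_mul_self_eq_abs, Fintype.sum_sum_type, Sum.elim_inl, Sum.elim_inr] at hs
  rw [traceAbsRpow, Fintype.sum_sum_type, hs, two_mul]
  rfl

end Dilation

section LocalConvexity

open Filter Topology

/-- A function with a supporting line at every point is continuous. -/
lemma continuous_of_forall_exists_support {φ : ℝ → ℝ}
    (h : ∀ t, ∃ K, ∀ s, φ t + K * (s - t) ≤ φ s) : Continuous φ := by
  have hconv : ConvexOn ℝ Set.univ φ := by
    refine ⟨convex_univ, fun x _ y _ α β hα hβ hαβ => ?_⟩
    obtain ⟨K, hK⟩ := h (α • x + β • y)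
    simp only [smul_eq_mul] at *
    have e : α * (x - (α * x + β * y)) + β * (y - (α * x + β * y)) = 0 := by
      linear_combination (-(α * x + β * y)) * hαβ
    calc φ (α * x + β * y)
        = (α + β) * φ (α * x + β * y)
          + K * (α * (x - (α * x + β * y)) + β * (y - (α * x + β * y))) := by
          rw [e, hαβ]; ring
      _ = α * (φ (α * x + β * y) + K * (x - (α * x + β * y)))
          + β * (φ (α * x + β * y) + K * (y - (α * x + β * y))) := by ring
      _ ≤ α * φ x + β * φ y := by gcongr <;> apply hK
  exact continuousOn_univ.1 (hconv.continuousOn isOpen_univ)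

/-- Local quadratic lower bounds at every point yield a global midpoint estimate. -/
lemma midpoint_le_of_local_quadratic_support {g : ℝ → ℝ} (hg : Continuous g) {c : ℝ}
    (h : ∀ t, ∀ c' < c, ∃ K, ∀ᶠ s in 𝓝 t, g t + K * (s - t) + c' * (s - t) ^ 2 ≤ g s) :
    g 0 + c ≤ (g 1 + g (-1)) / 2 := by
  suffices hs : ∀ c' < c, c' ≤ (g 1 + g (-1)) / 2 - g 0 by
    linarith [le_of_forall_lt_imp_le_of_dense hs]
  intro c' hc'
  by_contra! hlt
  set q : ℝ → ℝ := fun t => g t - c' * t ^ 2 - (g 1 - g (-1)) / 2 * t with hq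
  have hqc : Continuous q := by fun_prop
  obtain ⟨t, ht, hmax⟩ := (isCompact_Icc (a := (-1 : ℝ)) (b := 1)).exists_isMaxOn
    ⟨0, by norm_num⟩ hqc.continuousOn
  have h0 : q 0 ≤ q t := hmax (show (0 : ℝ) ∈ Set.Icc (-1) 1 by norm_num)
  have ht1 : t ≠ 1 := by
    rintro rfl
    simp only [hq] at h0
    linarith
  have ht2 : t ≠ -1 := by
    rintro rfl
    simp only [hq] at h0
    linarith
  have hnhds : Set.Icc (-1 : ℝ) 1 ∈ 𝓝 t :=
    Icc_mem_nhds (lt_of_le_of_ne ht.1 (Ne.symm ht2)) (lt_of_le_of_ne ht.2 ht1)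
  obtain ⟨K, hK⟩ := h t ((c + c') / 2) (by linarith)
  obtain ⟨δ, hδ, hball⟩ := Metric.eventually_nhds_iff.1 (hK.and hnhds)
  have hδ1 := hball (y := t + δ / 2)
    (by rw [Real.dist_eq, add_sub_cancel_left, abs_of_pos] <;> linarith)
  have hδ2 := hball (y := t - δ / 2)
    (by rw [Real.dist_eq, sub_sub_cancel_left, abs_neg, abs_of_pos] <;> linarith)
  have m1 : q (t + δ / 2) ≤ q t := hmax hδ1.2
  have m2 : q (t - δ / 2) ≤ q t := hmax hδ2.2
  have k1 := hδ1.1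
  have k2 := hδ2.1
  simp only [hq] at m1 m2
  nlinarith [mul_pos (sub_pos.2 hc') (pow_pos hδ 2)]

/-- If `φ` behaves like the `p`-th power of a `p`-uniformly convex norm along a line, then
`φ ^ (2 / p)` is strongly convex along this line. -/
lemma midpoint_rpow_le_of_quadratic_support {φ : ℝ → ℝ} {p β : ℝ} (hp1 : 1 < p) (hp2 : p ≤ 2)
    (hβ : 0 ≤ β) (hφ : ∀ t, 0 ≤ φ t)
    (hsupp : ∀ t, ∃ K, ∀ s T, (φ s + 2 * φ t) / 3 < T →
      φ t + K * (s - t) + p * (p - 1) / 2 * ((|s - t| ^ p * β) ^ (2 / p) * T ^ ((p - 2) / p))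
        ≤ φ s)
    (hzero : ∀ t, φ t = 0 → ∀ s, φ s = |s - t| ^ p * β) :
    φ 0 ^ (2 / p) + (p - 1) * β ^ (2 / p) ≤ (φ 1 ^ (2 / p) + φ (-1) ^ (2 / p)) / 2 := by
  have hp0 : 0 < p := by linarith
  have hp10 : 0 < p - 1 := by linarith
  have hsq : ∀ x : ℝ, (|x| ^ p * β) ^ (2 / p) = x ^ 2 * β ^ (2 / p) := by
    intro x
    rw [Real.mul_rpow (by positivity) hβ, ← Real.rpow_mul (abs_nonneg _),
      show p * (2 / p) = (2 : ℕ) by push_cast; field_simp, Real.rpow_natCast, sq_abs]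
  have hβ2 : 0 ≤ β ^ (2 / p) := Real.rpow_nonneg hβ _
  have hcont : Continuous φ := by
    refine continuous_of_forall_exists_support fun t => ?_
    obtain ⟨K, hK⟩ := hsupp t
    refine ⟨K, fun s => ?_⟩
    have h := hK s ((φ s + 2 * φ t) / 3 + 1) (by linarith)
    have hT : 0 ≤ ((φ s + 2 * φ t) / 3 + 1) ^ ((p - 2) / p) := Real.rpow_nonneg
      (by linarith [hφ s, hφ t]) _
    rw [hsq] at h
    have : 0 ≤ p * (p - 1) / 2 * ((s - t) ^ 2 * β ^ (2 / p)
      * ((φ s + 2 * φ t) / 3 + 1) ^ ((p - 2) / p)) := by positivity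
    linarith
  refine midpoint_le_of_local_quadratic_support (g := fun t => φ t ^ (2 / p))
    (hcont.rpow_const fun _ => Or.inr (by positivity)) fun t c' hc' => ?_
  rcases (hφ t).eq_or_lt with h0 | h0
  · refine ⟨0, Eventually.of_forall fun s => ?_⟩
    simp only [hzero t h0.symm, hsq]
    nlinarith [mul_le_mul_of_nonneg_left hc'.le (sq_nonneg (s - t)),
      mul_nonneg (mul_nonneg (sq_nonneg (s - t)) hβ2) (show 0 ≤ 2 - p by linarith)]
  · obtain ⟨K, hK⟩ := hsupp t
    have hlim : ∀ᶠ T in 𝓝 (φ t),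
        c' < (p - 1) * β ^ (2 / p) * (φ t ^ ((2 - p) / p) * T ^ ((p - 2) / p)) := by
      have hc : ContinuousAt (fun T : ℝ =>
          (p - 1) * β ^ (2 / p) * (φ t ^ ((2 - p) / p) * T ^ ((p - 2) / p))) (φ t) :=
        continuousAt_const.mul (continuousAt_const.mul
          (continuousAt_id.rpow_const (Or.inl h0.ne')))
      refine continuousAt_const.eventually_lt hc ?_
      rw [← Real.rpow_add h0, ← add_div]
      simpa using hc'
    obtain ⟨T, hTc, hT⟩ := ((hlim.filter_mono nhdsWithin_le_nhds).and
      (self_mem_nhdsWithin : Set.Ioi (φ t) ∈ 𝓝[>] (φ t))).exists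
    have hev : ∀ᶠ s in 𝓝 t, (φ s + 2 * φ t) / 3 < T := by
      refine ContinuousAt.eventually_lt (by fun_prop) continuousAt_const ?_
      have : φ t < T := hT
      linarith
    refine ⟨2 / p * φ t ^ ((2 - p) / p) * K, hev.mono fun s hs => ?_⟩
    have hKs := hK s T hs
    rw [hsq] at hKs
    have hexp : φ t ^ (2 / p) = φ t * φ t ^ ((2 - p) / p) := by
      rw [← Real.rpow_one_add' h0.le]
      · congr 1
        field_simp
        ring
      · have : 0 < 1 + (2 - p) / p := by
          have : 0 ≤ (2 - p) / p := div_nonneg (by linarith) hp0.le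
          linarith
        exact this.ne'
    have htan : φ t ^ (2 / p) + 2 / p * φ t ^ ((2 - p) / p) * (φ s - φ t) ≤ φ s ^ (2 / p) := by
      have hb := one_add_mul_self_le_rpow_one_add (s := φ s / φ t - 1)
        (by linarith [div_nonneg (hφ s) h0.le]) (p := 2 / p) (by rw [le_div_iff₀ hp0]; linarith)
      rw [add_sub_cancel, Real.div_rpow (hφ s) h0.le,
        le_div_iff₀ (Real.rpow_pos_of_pos h0 _)] at hb
      refine le_trans (le_of_eq ?_) hb
      rw [hexp]
      field_simp
    have hw : 0 ≤ 2 / p * φ t ^ ((2 - p) / p) := by positivity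
    have hstep := mul_le_mul_of_nonneg_left hKs hw
    have hquad := mul_le_mul_of_nonneg_right hTc.le (sq_nonneg (s - t))
    have e : 2 / p * φ t ^ ((2 - p) / p)
          * (p * (p - 1) / 2 * ((s - t) ^ 2 * β ^ (2 / p) * T ^ ((p - 2) / p)))
        = (p - 1) * β ^ (2 / p) * (φ t ^ ((2 - p) / p) * T ^ ((p - 2) / p)) * (s - t) ^ 2 := by
      field_simp
    linarith

end LocalConvexity

lemma two_rpow_mul_sq_schattenNorm {d : ℕ} {p : ℝ} (A : Matrix (Fin d) (Fin d) ℂ) :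
    2 ^ (2 / p) * schattenNorm p A ^ 2 = traceAbsRpow p (isHermitian_dilation A) ^ (2 / p) := by
  have h0 : 0 ≤ ∑ i, singularValues A i ^ p :=
    Finset.sum_nonneg fun _ _ => Real.rpow_nonneg (Real.sqrt_nonneg _) _
  rw [traceAbsRpow_dilation, Real.mul_rpow two_pos.le h0, schattenNorm, ← Real.rpow_natCast,
    ← Real.rpow_mul h0]
  congr 2
  push_cast
  ring

lemma dilation_add_smul {n : Type*} (A B : Matrix n n ℂ) (s t : ℝ) :
    fromBlocks 0 (A + (s : ℂ) • B) (A + (s : ℂ) • B)ᴴ 0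
      = fromBlocks 0 (A + (t : ℂ) • B) (A + (t : ℂ) • B)ᴴ 0
        + ((s - t : ℝ) : ℂ) • fromBlocks 0 B Bᴴ 0 := by
  rw [fromBlocks_smul, fromBlocks_add]
  simp only [smul_zero, add_zero, conjTranspose_add, conjTranspose_smul, Complex.star_def,
    Complex.conj_ofReal, Complex.ofReal_sub, sub_smul]
  congr 1 <;> abel

/-- **2-convexity of the Schatten classes (Ball–Carlen–Lieb).** For `1 < p ≤ 2` and all
`d × d` complex matrices `A`, `B`,
`‖A‖_p² + (p−1)‖B‖_p² ≤ (1/2)(‖A+B‖_p² + ‖A−B‖_p²)`;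
that is, `S_p^d` is 2-convex with constant `1/√(p−1)`. -/
theorem schatten_two_convex (d : ℕ) (p : ℝ) (hp1 : 1 < p) (hp2 : p ≤ 2)
    (A B : Matrix (Fin d) (Fin d) ℂ) :
    schattenNorm p A ^ 2 + (p - 1) * schattenNorm p B ^ 2
      ≤ (1 / 2) * (schattenNorm p (A + B) ^ 2 + schattenNorm p (A - B) ^ 2) := by
  have hHB := isHermitian_dilation B
  have hsmul : ∀ c : ℝ, ((c : ℂ) • fromBlocks 0 B Bᴴ 0).IsHermitian := fun c => by
    rw [Matrix.IsHermitian, conjTranspose_smul, hHB.eq, Complex.star_def, Complex.conj_ofReal]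
  have key := midpoint_rpow_le_of_quadratic_support
    (φ := fun t : ℝ => traceAbsRpow p (isHermitian_dilation (A + (t : ℂ) • B)))
    (β := traceAbsRpow p hHB) hp1 hp2 (traceAbsRpow_nonneg p hHB)
    (fun t => traceAbsRpow_nonneg p _) ?_ ?_
  · have e0 : A + ((0 : ℝ) : ℂ) • B = A := by simp
    have e1 : A + ((1 : ℝ) : ℂ) • B = A + B := by simp
    have e2 : A + ((-1 : ℝ) : ℂ) • B = A - B := by simp [sub_eq_add_neg]
    simp only [← two_rpow_mul_sq_schattenNorm, e0, e1, e2] at key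
    have h2 : (0 : ℝ) < 2 ^ (2 / p) := Real.rpow_pos_of_pos two_pos _
    refine le_of_mul_le_mul_left ?_ h2
    linarith
  · intro t
    obtain ⟨G, hG⟩ :=
      exists_subgradient_traceAbsRpow (isHermitian_dilation (A + (t : ℂ) • B)) hp1 hp2
    refine ⟨(G * fromBlocks 0 B Bᴴ 0).trace.re, fun s T hT => ?_⟩
    have h := hG _ _ (hsmul (s - t)) (isHermitian_dilation (A + (s : ℂ) • B))
      (dilation_add_smul A B s t) T hT
    rw [traceAbsRpow_smul p hHB (hsmul (s - t)) (s - t) rfl, Matrix.mul_smul, trace_smul,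
      smul_eq_mul, Complex.re_ofReal_mul, mul_comm (s - t)] at h
    exact h
  · intro t ht s
    have h0 := eq_zero_of_traceAbsRpow_eq_zero _ (by linarith) ht
    refine traceAbsRpow_smul p hHB _ (s - t) ?_
    rw [dilation_add_smul A B s t, h0, zero_add]

end
end
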